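/- arXiv:0711.2835 — 2 statements merged into one kernel-verified Lean document; each statement's English description precedes it below -/
import Mathlib

section
/- Let G be a Laman graph on a finite vertex set V with |V| = n ≥ 2. Then the edge set of G can be partitioned into two sets E₁ and E₂ such that each of the spanning subgraphs (V, E₁) and (V, E₂) is a forest (acyclic). -/
/-- A simple graph on `n ≥ 2` vertices is a Laman graph if it has exactly `2n - 3` edges and
every subset `S` of vertices with `|S| ≥ 2` spans at most `2|S| - 3` edges. -/
def IsLaman {V : Type*} [Fintype V] [DecidableEq V] (G : SimpleGraph V)
    [DecidableRel G.Adj] : Prop :=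
  G.edgeFinset.card = 2 * Fintype.card V - 3 ∧
    ∀ S : Finset V, 2 ≤ S.card →
      (G.edgeFinset.filter fun e => ∀ v ∈ e, v ∈ S).card ≤ 2 * S.card - 3

namespace LamanAux

open Finset

variable {V : Type*} [DecidableEq V]

open Classical in
/-- Edges of `E` spanned by `S`. -/
noncomputable def ed (E : Finset (Sym2 V)) (S : Finset V) : Finset (Sym2 V) :=
  E.filter fun e => ∀ v ∈ e, v ∈ S

/-- Counting version of being a forest. -/
def Forest (E : Finset (Sym2 V)) : Prop :=
  ∀ S : Finset V, S.Nonempty → (ed E S).card + 1 ≤ S.card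

/-- Laman sparsity. -/
def Sparse (E : Finset (Sym2 V)) : Prop :=
  ∀ S : Finset V, 2 ≤ S.card → (ed E S).card + 3 ≤ 2 * S.card

/-- Decomposition into two forests. -/
def Decomp (E : Finset (Sym2 V)) : Prop :=
  ∃ E₁ E₂ : Finset (Sym2 V), E₁ ∪ E₂ = E ∧ Forest E₁ ∧ Forest E₂

lemma mem_ed {E : Finset (Sym2 V)} {S : Finset V} {e : Sym2 V} :
    e ∈ ed E S ↔ e ∈ E ∧ ∀ v ∈ e, v ∈ S := by
  simp [ed]

lemma ed_mono {E F : Finset (Sym2 V)} {S T : Finset V} (h : E ⊆ F) (h' : S ⊆ T) :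
    ed E S ⊆ ed F T := by
  intro e he
  simp only [ed, mem_filter] at *
  exact ⟨h he.1, fun v hv => h' (he.2 v hv)⟩

lemma Forest.mono {E F : Finset (Sym2 V)} (hF : Forest F) (h : E ⊆ F) : Forest E := fun S hS =>
  (Nat.add_le_add_right (card_le_card (ed_mono h (Subset.refl S))) 1).trans (hF S hS)

lemma Sparse.mono {E F : Finset (Sym2 V)} (hF : Sparse F) (h : E ⊆ F) : Sparse E := fun S hS =>
  (Nat.add_le_add_right (card_le_card (ed_mono h (Subset.refl S))) 3).trans (hF S hS)

lemma ed_insert {E : Finset (Sym2 V)} {a b : V} (h : s(a, b) ∉ E) (S : Finset V) :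
    (ed (insert s(a, b) E) S).card = (ed E S).card + if a ∈ S ∧ b ∈ S then 1 else 0 := by
  unfold ed
  rw [filter_insert]
  simp only [Sym2.ball]
  split_ifs with h1
  · rw [card_insert_of_notMem]
    simp [h]
  · rfl

lemma ed_erase_vertex {E : Finset (Sym2 V)} {v : V} (h : ∀ e ∈ E, v ∉ e) (S : Finset V) :
    ed E (S.erase v) = ed E S := by
  ext e
  simp only [mem_ed]
  refine and_congr_right fun he => ?_
  constructor
  · intro H w hw
    exact mem_of_mem_erase (H w hw)
  · intro H w hw
    refine mem_erase.2 ⟨?_, H w hw⟩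
    rintro rfl
    exact h e he hw

lemma ed_of_card_le_one {E : Finset (Sym2 V)} (hd : ∀ e ∈ E, ¬ e.IsDiag) {S : Finset V}
    (hS : S.card ≤ 1) : ed E S = ∅ := by
  rw [eq_empty_iff_forall_notMem]
  intro e he'
  obtain ⟨he, H⟩ := mem_ed.1 he'
  have := hd e he
  induction e with
  | _ a b =>
    simp only [Sym2.ball] at H
    exact this (card_le_one.1 hS a H.1 b H.2)

lemma Forest.leaf {F : Finset (Sym2 V)} (hF : Forest F) {v x : V} (hv : ∀ e ∈ F, v ∉ e)
    (hx : x ≠ v) : Forest (insert s(v, x) F) := by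
  intro S hS
  have hn : s(v, x) ∉ F := fun h => hv _ h (by simp)
  rw [ed_insert hn]
  split_ifs with h
  · have h1 := hF (S.erase v) ⟨x, mem_erase.2 ⟨hx, h.2⟩⟩
    rw [ed_erase_vertex hv, card_erase_of_mem h.1] at h1
    omega
  · exact hF S hS

lemma Forest.subdiv {F : Finset (Sym2 V)} (hF : Forest F) {v x y : V} (hv : ∀ e ∈ F, v ∉ e)
    (hx : x ≠ v) (hy : y ≠ v) (hxy : x ≠ y) (he : s(x, y) ∈ F) :
    Forest (insert s(v, x) (insert s(v, y) (F.erase s(x, y)))) := by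
  intro S hS
  have hv' : ∀ e ∈ F.erase s(x, y), v ∉ e := fun e h => hv e (mem_of_mem_erase h)
  have hn1 : s(v, y) ∉ F.erase s(x, y) := fun h => hv' _ h (by simp)
  have hn2 : s(v, x) ∉ insert s(v, y) (F.erase s(x, y)) := by
    intro h
    rcases mem_insert.1 h with h | h
    · simp at h; tauto
    · exact hv' _ h (by simp)
  have h0 := ed_insert (notMem_erase s(x, y) F) S
  rw [insert_erase he] at h0
  rw [ed_insert hn2, ed_insert hn1]
  have h1 := hF S hS
  by_cases hvS : v ∈ S
  · by_cases hne : (S.erase v).Nonempty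
    · have h2 := hF (S.erase v) hne
      rw [ed_erase_vertex hv, card_erase_of_mem hvS] at h2
      have : 0 < S.card := card_pos.2 hS
      by_cases a : x ∈ S <;> by_cases b : y ∈ S <;> simp [hvS, a, b] at * <;> omega
    · have a : x ∉ S := fun h => hne ⟨x, mem_erase.2 ⟨hx, h⟩⟩
      have b : y ∉ S := fun h => hne ⟨y, mem_erase.2 ⟨hy, h⟩⟩
      simp [a, b] at *
      omega
  · simp [hvS]
    omega

lemma Decomp.type1 {E : Finset (Sym2 V)} (hE : Decomp E) {v x y : V} (hv : ∀ e ∈ E, v ∉ e)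
    (hx : x ≠ v) (hy : y ≠ v) : Decomp (insert s(v, x) (insert s(v, y) E)) := by
  obtain ⟨A, B, rfl, hA, hB⟩ := hE
  refine ⟨insert s(v, x) A, insert s(v, y) B, ?_,
    hA.leaf (fun e h => hv e (mem_union_left _ h)) hx,
    hB.leaf (fun e h => hv e (mem_union_right _ h)) hy⟩
  ext e
  simp only [mem_union, mem_insert]
  tauto

lemma Decomp.type2 {E : Finset (Sym2 V)} {v x y z : V} (hE : Decomp (insert s(x, y) E))
    (hn : s(x, y) ∉ E) (hv : ∀ e ∈ E, v ∉ e)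
    (hx : x ≠ v) (hy : y ≠ v) (hz : z ≠ v) (hxy : x ≠ y) :
    Decomp (insert s(v, x) (insert s(v, y) (insert s(v, z) E))) := by
  obtain ⟨A, B, hAB, hA, hB⟩ := hE
  wlog h : s(x, y) ∈ A generalizing A B
  · refine this B A (by rw [union_comm, hAB]) hB hA ?_
    have : s(x, y) ∈ A ∪ B := by rw [hAB]; exact mem_insert_self _ _
    exact (mem_union.1 this).resolve_left h
  have hv' : ∀ e ∈ A ∪ B, v ∉ e := by
    rw [hAB]
    intro e he
    rcases mem_insert.1 he with rfl | he
    · simp [hx.symm, hy.symm]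
    · exact hv e he
  refine ⟨_, insert s(v, z) (B.erase s(x, y)), ?_,
    hA.subdiv (fun e h => hv' e (mem_union_left _ h)) hx hy hxy h,
    (hB.mono (erase_subset _ _)).leaf
      (fun e h => hv' e (mem_union_right _ (mem_of_mem_erase h))) hz⟩
  have hE : E = (A ∪ B).erase s(x, y) := by rw [hAB, erase_insert hn]
  rw [hE]
  ext e
  simp only [mem_union, mem_insert, mem_erase]
  tauto

lemma pair_or {E : Finset (Sym2 V)} (hE : Sparse E) {x y : V} (hxy : x ≠ y) :
    (s(x, y) ∉ E ∧ Sparse (insert s(x, y) E)) ∨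
      ∃ A : Finset V, x ∈ A ∧ y ∈ A ∧ 2 * A.card ≤ (ed E A).card + 3 := by
  by_cases hn : s(x, y) ∈ E
  · right
    refine ⟨{x, y}, by simp, by simp, ?_⟩
    rw [card_pair hxy]
    have : 0 < (ed E {x, y}).card := card_pos.2 ⟨s(x, y), by simp [ed, hn]⟩
    omega
  · by_contra! H
    refine H.1 hn ?_
    intro S hS
    rw [ed_insert hn]
    have h1 := hE S hS
    split_ifs with h
    · have := H.2 S h.1 h.2
      omega
    · omega

lemma ed_inter (E : Finset (Sym2 V)) (A B : Finset V) : ed E A ∩ ed E B = ed E (A ∩ B) := by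
  ext e
  simp only [ed, mem_inter, mem_filter]
  constructor
  · rintro ⟨⟨h, h1⟩, _, h2⟩
    exact ⟨h, fun v hv => ⟨h1 v hv, h2 v hv⟩⟩
  · rintro ⟨h, h1⟩
    exact ⟨⟨h, fun v hv => (h1 v hv).1⟩, h, fun v hv => (h1 v hv).2⟩

lemma small_inter {E : Finset (Sym2 V)} (hE : Sparse E) {A B : Finset V}
    (hA : 2 * A.card ≤ (ed E A).card + 3) (hB : 2 * B.card ≤ (ed E B).card + 3)
    (hU : (ed E (A ∪ B)).card + 4 ≤ 2 * (A ∪ B).card) : (A ∩ B).card ≤ 1 := by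
  by_contra! h
  have h1 := hE (A ∩ B) h
  have h2 := card_union_add_card_inter A B
  have h3 := card_union_add_card_inter (ed E A) (ed E B)
  rw [ed_inter] at h3
  have h4 : (ed E A ∪ ed E B).card ≤ (ed E (A ∪ B)).card :=
    card_le_card (union_subset (ed_mono (Subset.refl E) subset_union_left)
      (ed_mono (Subset.refl E) subset_union_right))
  omega

lemma exists_pair {E : Finset (Sym2 V)} (hE : Sparse E) (hd : ∀ e ∈ E, ¬ e.IsDiag) {x y z : V}
    (hxy : x ≠ y) (hyz : y ≠ z) (hxz : x ≠ z)
    (hno : ∀ U : Finset V, x ∈ U → y ∈ U → z ∈ U → (ed E U).card + 4 ≤ 2 * U.card) :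
    (s(x, y) ∉ E ∧ Sparse (insert s(x, y) E)) ∨ (s(y, z) ∉ E ∧ Sparse (insert s(y, z) E)) ∨
      (s(x, z) ∉ E ∧ Sparse (insert s(x, z) E)) := by
  rcases pair_or hE hxy with h | ⟨A, xA, yA, hA⟩
  · exact Or.inl h
  rcases pair_or hE hyz with h | ⟨B, yB, zB, hB⟩
  · exact Or.inr (Or.inl h)
  rcases pair_or hE hxz with h | ⟨C, xC, zC, hC⟩
  · exact Or.inr (Or.inr h)
  exfalso
  have hAB := small_inter hE hA hB
    (hno _ (mem_union_left _ xA) (mem_union_left _ yA) (mem_union_right _ zB))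
  have hAC := small_inter hE hA hC
    (hno _ (mem_union_left _ xA) (mem_union_left _ yA) (mem_union_right _ zC))
  have hBC := small_inter hE hB hC
    (hno _ (mem_union_right _ xC) (mem_union_left _ yB) (mem_union_left _ zB))
  have dis : ∀ {P Q : Finset V}, (P ∩ Q).card ≤ 1 → Disjoint (ed E P) (ed E Q) := by
    intro P Q h
    rw [disjoint_iff_inter_eq_empty, ed_inter, ed_of_card_le_one hd h]
  have hU := hno (A ∪ B ∪ C) (by simp [xA]) (by simp [yA]) (by simp [zC])
  have h1 : (ed E A ∪ ed E B ∪ ed E C).card = (ed E A).card + (ed E B).card + (ed E C).card := by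
    rw [card_union_of_disjoint (disjoint_union_left.2 ⟨dis hAC, dis hBC⟩),
      card_union_of_disjoint (dis hAB)]
  have h2 : (ed E A ∪ ed E B ∪ ed E C).card ≤ (ed E (A ∪ B ∪ C)).card := by
    apply card_le_card
    refine union_subset (union_subset ?_ ?_) ?_ <;> apply ed_mono (Subset.refl E) <;> intro a <;>
      simp +contextual
  have h3 := card_union_add_card_inter A B
  have h4 := card_union_add_card_inter (A ∪ B) C
  have h5 : 1 ≤ (A ∩ B).card := card_pos.2 ⟨y, by simp [yA, yB]⟩
  have h6 : 2 ≤ ((A ∪ B) ∩ C).card := by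
    rw [← card_pair hxz]
    apply card_le_card
    intro a
    simp only [mem_insert, mem_singleton, mem_inter, mem_union]
    rintro (rfl | rfl) <;> simp [xA, xC, zB, zC]
  omega

lemma exists_vertex [Fintype V] {E : Finset (Sym2 V)} (hE : Sparse E)
    (hd : ∀ e ∈ E, ¬ e.IsDiag) (hne : E.Nonempty) :
    ∃ v : V, 1 ≤ (E.filter fun e => v ∈ e).card ∧ (E.filter fun e => v ∈ e).card ≤ 3 := by
  by_contra! H
  have h1 : ∑ v : V, (E.filter fun e => v ∈ e).card = 2 * E.card := by
    have := sum_card_bipartiteAbove_eq_sum_card_bipartiteBelow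
      (s := (univ : Finset V)) (t := E) (fun v e => v ∈ e)
    unfold bipartiteAbove bipartiteBelow at this
    rw [this, sum_congr rfl (g := fun _ => 2)]
    · simp [mul_comm]
    · intro e he
      rw [← Sym2.card_toFinset_of_not_isDiag e (hd e he)]
      congr 1
      ext v
      simp
  set T : Finset V := univ.filter fun v => 1 ≤ (E.filter fun e => v ∈ e).card with hT
  have hmem : ∀ e ∈ E, ∀ v ∈ e, v ∈ T := by
    intro e he v hv
    simp only [hT, mem_filter, mem_univ, true_and]
    exact card_pos.2 ⟨e, by simp [he, hv]⟩
  have h2 : ed E T = E := by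
    ext e
    rw [mem_ed]
    exact ⟨fun h => h.1, fun h => ⟨h, hmem e h⟩⟩
  have h3 : 2 ≤ T.card := by
    obtain ⟨e, he⟩ := hne
    rw [← Sym2.card_toFinset_of_not_isDiag e (hd e he)]
    apply card_le_card
    intro v hv
    exact hmem e he v (by simpa using hv)
  have h4 := hE T h3
  rw [h2] at h4
  have h5 : T.card * 4 ≤ ∑ v ∈ T, (E.filter fun e => v ∈ e).card := by
    rw [← smul_eq_mul]
    apply card_nsmul_le_sum
    intro v hv
    exact H v (mem_filter.1 hv).2
  have h6 : ∑ v ∈ T, (E.filter fun e => v ∈ e).card ≤ ∑ v : V, (E.filter fun e => v ∈ e).card :=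
    sum_le_sum_of_subset (subset_univ _)
  omega

lemma star_mem {E : Finset (Sym2 V)} (hd : ∀ e ∈ E, ¬ e.IsDiag) {v : V} {e : Sym2 V}
    (he : e ∈ E.filter fun e => v ∈ e) : ∃ x, x ≠ v ∧ e = s(v, x) := by
  obtain ⟨h, hv⟩ := mem_filter.1 he
  obtain ⟨x, rfl⟩ := hv
  refine ⟨x, ?_, rfl⟩
  rintro rfl
  exact hd _ h rfl

theorem decomp [Fintype V] (n : ℕ) : ∀ E : Finset (Sym2 V), E.card = n → Sparse E →
    (∀ e ∈ E, ¬ e.IsDiag) → Decomp E := by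
  induction n using Nat.strong_induction_on with
  | _ n ih =>
  intro E hn hE hd
  rcases E.eq_empty_or_nonempty with rfl | hne
  · refine ⟨∅, ∅, rfl, ?_, ?_⟩ <;>
    · intro S hS
      simpa [ed] using hS.card_pos
  obtain ⟨v, hv1, hv3⟩ := exists_vertex hE hd hne
  set D := E.filter fun e => v ∈ e with hD
  set E₀ := E.filter fun e => ¬ v ∈ e with hE₀
  have hcard : D.card + E₀.card = E.card := card_filter_add_card_filter_not _
  have hun : D ∪ E₀ = E := filter_union_filter_not_eq _ _
  have hsub : E₀ ⊆ E := filter_subset _ _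
  have hv : ∀ e ∈ E₀, v ∉ e := fun e he => (mem_filter.1 he).2
  have hd₀ : ∀ e ∈ E₀, ¬ e.IsDiag := fun e he => hd e (hsub he)
  have hS₀ : Sparse E₀ := hE.mono hsub
  have hstar : ∀ e ∈ D, ∃ x, x ≠ v ∧ e = s(v, x) := fun e he => star_mem hd he
  obtain h | h | h : D.card = 1 ∨ D.card = 2 ∨ D.card = 3 := by omega
  · obtain ⟨e, he⟩ := card_eq_one.1 h
    obtain ⟨x, hx, rfl⟩ := hstar e (by simp [he])
    have := (ih _ (by omega) E₀ rfl hS₀ hd₀).type1 hv hx hx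
    rw [← hun, he]
    convert this using 1
    ext e
    simp
  · obtain ⟨e, f, -, he⟩ := card_eq_two.1 h
    obtain ⟨x, hx, rfl⟩ := hstar e (by simp [he])
    obtain ⟨y, hy, rfl⟩ := hstar f (by simp [he])
    have := (ih _ (by omega) E₀ rfl hS₀ hd₀).type1 hv hx hy
    rw [← hun, he]
    convert this using 1
    ext e
    simp [or_assoc]
  · obtain ⟨e, f, g, hef, heg, hfg, he⟩ := card_eq_three.1 h
    obtain ⟨x, hx, rfl⟩ := hstar e (by simp [he])
    obtain ⟨y, hy, rfl⟩ := hstar f (by simp [he])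
    obtain ⟨z, hz, rfl⟩ := hstar g (by simp [he])
    have hxy : x ≠ y := by rintro rfl; exact hef rfl
    have hxz : x ≠ z := by rintro rfl; exact heg rfl
    have hyz : y ≠ z := by rintro rfl; exact hfg rfl
    have hno : ∀ U : Finset V, x ∈ U → y ∈ U → z ∈ U →
        (ed E₀ U).card + 4 ≤ 2 * U.card := by
      intro U xU yU zU
      have h1 := hE (insert v U) (by
        rw [← card_pair hxy]
        apply card_le_card
        intro a
        simp only [mem_insert, mem_singleton]
        rintro (rfl | rfl) <;> simp [xU, yU])
      have h2 : D ∪ ed E₀ U ⊆ ed E (insert v U) := by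
        apply union_subset
        · rw [he]
          have : ∀ e ∈ D, e ∈ E := fun e h => (mem_filter.1 h).1
          intro e h
          have h' := this e (by rw [he]; exact h)
          simp only [mem_insert, mem_singleton] at h
          rcases h with rfl | rfl | rfl <;> simp [ed, h', xU, yU, zU]
        · exact ed_mono hsub (subset_insert _ _)
      have h3 : Disjoint D (ed E₀ U) := by
        rw [disjoint_left]
        intro e h h'
        exact hv e (mem_ed.1 h').1 (mem_filter.1 h).2
      have h4 := card_le_card h2
      rw [card_union_of_disjoint h3] at h4
      have h5 := card_insert_le v U
      omega
    have key : ∀ a b c : V, a ≠ v → b ≠ v → c ≠ v → a ≠ b →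
        (s(a, b) ∉ E₀ ∧ Sparse (insert s(a, b) E₀)) →
        Decomp (insert s(v, a) (insert s(v, b) (insert s(v, c) E₀))) := by
      rintro a b c ha hb hc hab ⟨h1, h2⟩
      refine Decomp.type2 (ih _ ?_ _ rfl h2 ?_) h1 hv ha hb hc hab
      · rw [card_insert_of_notMem h1]
        omega
      · intro e he
        rcases mem_insert.1 he with rfl | he
        · simpa using hab
        · exact hd₀ e he
    rw [← hun, he]
    rcases exists_pair hS₀ hd₀ hxy hyz hxz hno with H | H | H
    · convert key x y z hx hy hz hxy H using 1
      ext e; simp only [mem_union, mem_insert, mem_singleton]; tauto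
    · convert key y z x hy hz hx hyz H using 1
      ext e; simp only [mem_union, mem_insert, mem_singleton]; tauto
    · convert key x z y hx hz hy hxz H using 1
      ext e; simp only [mem_union, mem_insert, mem_singleton]; tauto

lemma Forest.isAcyclic {F : Finset (Sym2 V)} (hF : Forest F) :
    (SimpleGraph.fromEdgeSet (↑F : Set (Sym2 V))).IsAcyclic := by
  intro u c hc
  have h1 : c.edges.toFinset.card = c.length := by
    rw [List.toFinset_card_of_nodup hc.edges_nodup, SimpleGraph.Walk.length_edges]
  have h2 : c.support.tail.toFinset.card = c.length := by
    rw [List.toFinset_card_of_nodup hc.support_nodup]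
    simp
  have h3 : 3 ≤ c.length := hc.three_le_length
  have h4 := hF c.support.tail.toFinset (card_pos.1 (by omega))
  have h5 : c.edges.toFinset ⊆ ed F c.support.tail.toFinset := by
    intro e he
    rw [List.mem_toFinset] at he
    have := c.edges_subset_edgeSet he
    simp only [SimpleGraph.edgeSet_fromEdgeSet, Set.mem_sdiff, mem_coe] at this
    refine mem_ed.2 ⟨this.1, fun v hv => ?_⟩
    rw [List.mem_toFinset]
    have hvs : v ∈ c.support := c.mem_support_of_mem_edges he hv
    rw [SimpleGraph.Walk.mem_support_iff] at hvs
    rcases hvs with rfl | h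
    · exact SimpleGraph.Walk.end_mem_tail_support hc.not_nil
    · exact h
  have := card_le_card h5
  omega

end LamanAux

/-- The edge set of a Laman graph can be partitioned into two forests. -/
theorem laman_partition_two_forests {V : Type*} [Fintype V] [DecidableEq V]
    (G : SimpleGraph V) [DecidableRel G.Adj] (n : ℕ) (hn : Fintype.card V = n)
    (h2 : 2 ≤ n) (hG : IsLaman G) :
    ∃ E₁ E₂ : Finset (Sym2 V), E₁ ∪ E₂ = G.edgeFinset ∧ Disjoint E₁ E₂ ∧
      (SimpleGraph.fromEdgeSet (↑E₁ : Set (Sym2 V))).IsAcyclic ∧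
      (SimpleGraph.fromEdgeSet (↑E₂ : Set (Sym2 V))).IsAcyclic := by
  obtain ⟨A, B, hAB, hA, hB⟩ := LamanAux.decomp _ G.edgeFinset rfl
    (fun S hS => by
      have := hG.2 S hS
      have h : (LamanAux.ed G.edgeFinset S).card ≤ 2 * S.card - 3 := by
        unfold LamanAux.ed
        convert this
      omega)
    (fun e he => G.not_isDiag_of_mem_edgeFinset he)
  exact ⟨A, B \ A, by rw [Finset.union_sdiff_self_eq_union, hAB], Finset.disjoint_sdiff,
    hA.isAcyclic, (hB.mono Finset.sdiff_subset).isAcyclic⟩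
end

section
/- Let G be a Laman graph on a finite vertex set V with |V| = n ≥ 2. Then the edge set of G can be partitioned into two sets E₁ and E₂ such that the spanning subgraph (V, E₁) is a tree (connected and acyclic, hence with n − 1 edges) and the spanning subgraph (V, E₂) is a forest with exactly two connected components (hence with n − 2 edges). -/
theorem reach_const {V α : Type*} {G : SimpleGraph V} (g : V → α)
    (h : ∀ x y, G.Adj x y → g x = g y) {x y : V} (r : G.Reachable x y) : g x = g y := by
  obtain ⟨p⟩ := r
  induction p with
  | nil => rfl
  | cons hadj _ ih => exact (h _ _ hadj).trans ih

theorem card_cc_sup_edge {V : Type*} [Finite V] {G : SimpleGraph V} {u v : V}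
    (h : ¬ G.Reachable u v) :
    Nat.card (G ⊔ SimpleGraph.edge u v).ConnectedComponent + 1 = Nat.card G.ConnectedComponent := by
  classical
  have := Fintype.ofFinite V
  have := Fintype.ofFinite G.ConnectedComponent
  set G' := G ⊔ SimpleGraph.edge u v with hG'
  have hle : G ≤ G' := le_sup_left
  have huv : G'.Reachable u v := by
    by_cases e : u = v
    · subst e; rfl
    · apply SimpleGraph.Adj.reachable
      simp [hG', SimpleGraph.edge_adj, e]
  let cv := G.connectedComponentMk v
  let cu := G.connectedComponentMk u
  have hne : cu ≠ cv := by
    intro e; exact h (SimpleGraph.ConnectedComponent.exact e)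
  let g : V → G.ConnectedComponent := fun x =>
    if G.connectedComponentMk x = cv then cu else G.connectedComponentMk x
  have hg : ∀ x y, G'.Adj x y → g x = g y := by
    intro x y hxy
    rw [hG', SimpleGraph.sup_adj, SimpleGraph.edge_adj] at hxy
    rcases hxy with hxy | ⟨⟨rfl, rfl⟩ | ⟨rfl, rfl⟩, _⟩
    · have : G.connectedComponentMk x = G.connectedComponentMk y :=
        SimpleGraph.ConnectedComponent.sound hxy.reachable
      simp [g, this]
    · simp [g, cu, cv]
    · simp [g, cu, cv]
  let f : {c : G.ConnectedComponent // c ≠ cv} → G'.ConnectedComponent :=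
    fun c => c.1.map (SimpleGraph.Hom.ofLE hle)
  have hf : Function.Bijective f := by
    constructor
    · rintro ⟨c, hc⟩ ⟨d, hd⟩ hcd
      induction c using SimpleGraph.ConnectedComponent.ind with | _ x
      induction d using SimpleGraph.ConnectedComponent.ind with | _ y
      have hxy : G'.Reachable x y := SimpleGraph.ConnectedComponent.exact hcd
      have := reach_const g hg hxy
      simp only [g, hc, hd, if_false] at this
      exact Subtype.ext this
    · intro c
      induction c using SimpleGraph.ConnectedComponent.ind with | _ x
      by_cases hx : G.connectedComponentMk x = cv
      · refine ⟨⟨cu, hne⟩, ?_⟩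
        have h1 : G'.Reachable x v := (SimpleGraph.ConnectedComponent.exact hx).mono hle
        exact SimpleGraph.ConnectedComponent.sound (huv.trans h1.symm)
      · exact ⟨⟨_, hx⟩, rfl⟩
  rw [← Nat.card_congr (Equiv.ofBijective f hf), Nat.card_eq_fintype_card,
    Nat.card_eq_fintype_card, Fintype.card_subtype_compl, Fintype.card_subtype_eq]
  have : 0 < Fintype.card G.ConnectedComponent := Fintype.card_pos_iff.2 ⟨cv⟩
  omega

/-- The graph on `V` with edge set `E`. -/
abbrev gr {V : Type*} (E : Finset (Sym2 V)) : SimpleGraph V :=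
  SimpleGraph.fromEdgeSet (↑E : Set (Sym2 V))

theorem gr_insert {V : Type*} [DecidableEq V] (E : Finset (Sym2 V)) (u v : V) :
    gr (insert s(u, v) E) = gr E ⊔ SimpleGraph.edge u v := by
  ext x y
  simp only [gr, SimpleGraph.fromEdgeSet_adj, SimpleGraph.sup_adj, SimpleGraph.edge_adj,
    Finset.coe_insert, Set.mem_insert_iff, Sym2.eq_iff, Finset.mem_coe]
  tauto

theorem not_reach_of_acyclic {V : Type*} [DecidableEq V] {E : Finset (Sym2 V)} {u v : V}
    (hne : u ≠ v) (hE : s(u, v) ∉ E) (hac : (gr (insert s(u, v) E)).IsAcyclic) :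
    ¬ (gr E).Reachable u v := by
  rw [SimpleGraph.isAcyclic_iff_forall_isBridge] at hac
  have h1 := hac (e := s(u, v)) (by simp [hne])
  rw [SimpleGraph.isBridge_iff] at h1
  intro h
  apply h1
  refine h.mono ?_
  intro x y hxy
  simp only [gr, SimpleGraph.fromEdgeSet_adj, SimpleGraph.deleteEdges_adj,
    Finset.coe_insert, Set.mem_insert_iff, Finset.mem_coe, Set.mem_singleton_iff] at hxy ⊢
  refine ⟨⟨Or.inr hxy.1, hxy.2⟩, ?_⟩
  intro e
  rw [e] at hxy
  exact hE hxy.1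

theorem gr_mono {V : Type*} {E F : Finset (Sym2 V)} (h : E ⊆ F) : gr E ≤ gr F :=
  SimpleGraph.fromEdgeSet_mono (by exact_mod_cast h)

theorem forest_card {V : Type*} [Fintype V] [DecidableEq V] (E : Finset (Sym2 V))
    (hd : ∀ e ∈ E, ¬ e.IsDiag) (hac : (gr E).IsAcyclic) :
    Nat.card (gr E).ConnectedComponent + E.card = Fintype.card V := by
  induction E using Finset.induction_on with
  | empty =>
    have : gr (∅ : Finset (Sym2 V)) = ⊥ := by simp [gr]
    rw [this]
    have hb : Function.Bijective ((⊥ : SimpleGraph V).connectedComponentMk) := by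
      constructor
      · intro x y h
        simpa using SimpleGraph.ConnectedComponent.exact h
      · intro c
        induction c using SimpleGraph.ConnectedComponent.ind with | _ x
        exact ⟨x, rfl⟩
    rw [← Nat.card_congr (Equiv.ofBijective _ hb)]
    simp
  | insert e E he ih =>
    induction e using Sym2.ind with | _ u v
    have hne : u ≠ v := by simpa using hd s(u, v) (by simp)
    have h1 := not_reach_of_acyclic hne he hac
    have h2 := ih (fun e h => hd e (by simp [h]))
      (hac.anti (gr_mono (Finset.subset_insert _ _)))
    have h3 := card_cc_sup_edge h1
    rw [gr_insert, Finset.card_insert_of_notMem he]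
    omega

theorem isolated_not_reach {V : Type*} {E : Finset (Sym2 V)} {v x : V}
    (hv : ∀ e ∈ E, v ∉ e) (hne : v ≠ x) : ¬ (gr E).Reachable v x := by
  intro h
  have := reach_const (G := gr E) (fun y => v = y) (by
    intro a b hab
    have h1 := hv _ hab.1
    simp only [Sym2.mem_iff, not_or] at h1
    simp [h1]) h
  exact hne (by simpa using this)

theorem acyclic_leaf {V : Type*} [DecidableEq V] {E : Finset (Sym2 V)} {v x : V}
    (hv : ∀ e ∈ E, v ∉ e) (hne : v ≠ x) (h : (gr E).IsAcyclic) :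
    (gr (insert s(v, x) E)).IsAcyclic := by
  rw [gr_insert]
  exact h.sup_edge_of_not_reachable (isolated_not_reach hv hne)

theorem acyclic_subdiv {V : Type*} [DecidableEq V] {E : Finset (Sym2 V)} {v x y : V}
    (hv : ∀ e ∈ E, v ∉ e) (hx : v ≠ x) (hy : v ≠ y) (hr : ¬ (gr E).Reachable x y)
    (h : (gr E).IsAcyclic) :
    (gr (insert s(v, y) (insert s(v, x) E))).IsAcyclic := by
  rw [gr_insert]
  refine (acyclic_leaf hv hx h).sup_edge_of_not_reachable ?_
  intro hvy
  let g : V → (gr E).ConnectedComponent := fun z =>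
    (gr E).connectedComponentMk (if z = v then x else z)
  have := reach_const g (by
    intro a b hab
    rw [gr_insert, SimpleGraph.sup_adj, SimpleGraph.edge_adj] at hab
    rcases hab with hab | ⟨⟨rfl, rfl⟩ | ⟨rfl, rfl⟩, _⟩
    · have h1 := hv _ hab.1
      simp only [Sym2.mem_iff, not_or] at h1
      simp only [g, if_neg (Ne.symm h1.1), if_neg (Ne.symm h1.2)]
      exact SimpleGraph.ConnectedComponent.sound hab.reachable
    · simp [g]
    · simp [g]) hvy
  simp only [g, if_true, if_neg (Ne.symm hy)] at this
  exact hr (SimpleGraph.ConnectedComponent.exact this)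

/-- Edge set decomposable into two disjoint forests. -/
def Dec {V : Type*} [DecidableEq V] (E : Finset (Sym2 V)) : Prop :=
  ∃ E₁ E₂ : Finset (Sym2 V), E₁ ∪ E₂ = E ∧ Disjoint E₁ E₂ ∧
    (gr E₁).IsAcyclic ∧ (gr E₂).IsAcyclic

open Classical in
/-- Edges spanned by `S`. -/
noncomputable def ind {V : Type*} [DecidableEq V] (E : Finset (Sym2 V)) (S : Finset V) : Finset (Sym2 V) :=
  E.filter fun e => ∀ v ∈ e, v ∈ S

/-- Laman sparsity. -/
def Sparse {V : Type*} [DecidableEq V] (E : Finset (Sym2 V)) : Prop :=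
  (∀ e ∈ E, ¬ e.IsDiag) ∧ ∀ S : Finset V, 2 ≤ S.card → (ind E S).card + 3 ≤ 2 * S.card

section
variable {V : Type*} [DecidableEq V]

theorem mem_ind {E : Finset (Sym2 V)} {S : Finset V} {e : Sym2 V} :
    e ∈ ind E S ↔ e ∈ E ∧ ∀ v ∈ e, v ∈ S := by simp [ind]

theorem ind_mono {E F : Finset (Sym2 V)} (h : E ⊆ F) {S T : Finset V} (hS : S ⊆ T) :
    ind E S ⊆ ind F T := by
  intro e he
  rw [mem_ind] at *
  exact ⟨h he.1, fun v hv => hS (he.2 v hv)⟩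

theorem Sparse.mono {E F : Finset (Sym2 V)} (h : E ⊆ F) (hF : Sparse F) : Sparse E :=
  ⟨fun e he => hF.1 e (h he), fun S hS => by
    have h1 := Finset.card_le_card (ind_mono h (le_refl S))
    have h2 := hF.2 S hS
    omega⟩

theorem ind_supermod (E : Finset (Sym2 V)) (A B : Finset V) :
    (ind E A).card + (ind E B).card ≤ (ind E (A ∪ B)).card + (ind E (A ∩ B)).card := by
  rw [← Finset.card_union_add_card_inter]
  apply Nat.add_le_add
  · exact Finset.card_le_card (Finset.union_subset
      (ind_mono (le_refl _) Finset.subset_union_left)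
      (ind_mono (le_refl _) Finset.subset_union_right))
  · apply Finset.card_le_card
    intro e he
    simp only [Finset.mem_inter, mem_ind] at *
    exact ⟨he.1.1, fun v hv => ⟨he.1.2 v hv, he.2.2 v hv⟩⟩

theorem ind_disj {E : Finset (Sym2 V)} (hd : ∀ e ∈ E, ¬ e.IsDiag) {A B : Finset V}
    (h : (A ∩ B).card ≤ 1) : Disjoint (ind E A) (ind E B) := by
  rw [Finset.disjoint_left]
  intro e hA hB
  rw [mem_ind] at hA hB
  induction e using Sym2.ind with | _ u v
  have hne : u ≠ v := by simpa using hd _ hA.1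
  rw [Finset.card_le_one] at h
  exact hne (h u (by simp [hA.2 u, hB.2 u]) v (by simp [hA.2 v, hB.2 v]))

theorem tight_union {E : Finset (Sym2 V)} (hE : Sparse E) {A B : Finset V}
    (hA : 2 * A.card ≤ (ind E A).card + 3) (hB : 2 * B.card ≤ (ind E B).card + 3)
    (h : 2 ≤ (A ∩ B).card) : 2 * (A ∪ B).card ≤ (ind E (A ∪ B)).card + 3 := by
  have h1 := ind_supermod E A B
  have h2 := hE.2 _ h
  have h3 := Finset.card_union_add_card_inter A B
  omega

theorem exists_tight {E : Finset (Sym2 V)} {v x y : V} (hE : Sparse E)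
    (hv : ∀ e ∈ E, v ∉ e) (hxy : x ≠ y) (hx : v ≠ x) (hy : v ≠ y)
    (h : ¬ (s(x, y) ∉ E ∧ Sparse (insert s(x, y) E))) :
    ∃ S : Finset V, x ∈ S ∧ y ∈ S ∧ v ∉ S ∧ 2 * S.card ≤ (ind E S).card + 3 := by
  by_cases hm : s(x, y) ∈ E
  · refine ⟨{x, y}, by simp, by simp, by simp [hx, hy], ?_⟩
    rw [Finset.card_pair hxy]
    have : 0 < (ind E {x, y}).card := Finset.card_pos.2 ⟨s(x, y), by simp [mem_ind, hm]⟩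
    omega
  · have hs : ¬ Sparse (insert s(x, y) E) := fun hs => h ⟨hm, hs⟩
    simp only [Sparse, not_and, not_forall] at hs
    obtain ⟨S, hS2, hS⟩ := hs (by
      intro e he
      rcases Finset.mem_insert.1 he with rfl | he
      · simpa using hxy
      · exact hE.1 e he)
    have hle : (ind (insert s(x, y) E) S).card ≤ (ind E S).card + 1 := by
      refine (Finset.card_le_card (t := insert s(x, y) (ind E S)) ?_).trans
        (Finset.card_insert_le _ _)
      intro e he
      simp only [mem_ind, Finset.mem_insert] at *
      tauto
    have hmem : x ∈ S ∧ y ∈ S := by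
      by_contra hc
      have : ind (insert s(x, y) E) S ⊆ ind E S := by
        intro e he
        simp only [mem_ind, Finset.mem_insert] at *
        refine ⟨?_, he.2⟩
        rcases he.1 with rfl | h1
        · exact absurd ⟨he.2 x (by simp), he.2 y (by simp)⟩ hc
        · exact h1
      have := Finset.card_le_card this
      have := hE.2 S hS2
      omega
    refine ⟨S.erase v, by simp [hmem, hx.symm], by simp [hmem, hy.symm], by simp, ?_⟩
    have h1 : ind E S ⊆ ind E (S.erase v) := by
      intro e he
      simp only [mem_ind] at *
      refine ⟨he.1, fun w hw => Finset.mem_erase.2 ⟨?_, he.2 w hw⟩⟩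
      rintro rfl
      exact hv e he.1 hw
    have := Finset.card_le_card h1
    have := Finset.card_erase_le (s := S) (a := v)
    omega

theorem no_block {E : Finset (Sym2 V)} {v a b c : V}
    (hv : ∀ e ∈ E, v ∉ e) (hab : a ≠ b) (hac : a ≠ c) (hbc : b ≠ c)
    (hE : Sparse (insert s(v, a) (insert s(v, b) (insert s(v, c) E))))
    {T : Finset V} (ha : a ∈ T) (hb : b ∈ T) (hc : c ∈ T) (hvT : v ∉ T) :
    (ind E T).card + 4 ≤ 2 * T.card := by
  have h1 := hE.2 (insert v T) (by
    rw [Finset.card_insert_of_notMem hvT]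
    have := Finset.card_pos.2 ⟨a, ha⟩
    omega)
  rw [Finset.card_insert_of_notMem hvT] at h1
  have h2 : insert s(v, a) (insert s(v, b) (insert s(v, c) (ind E T))) ⊆
      ind (insert s(v, a) (insert s(v, b) (insert s(v, c) E))) (insert v T) := by
    intro e he
    simp only [Finset.mem_insert] at he
    rcases he with rfl | rfl | rfl | he
    · simp [mem_ind, ha]
    · simp [mem_ind, hb]
    · simp [mem_ind, hc]
    · rw [mem_ind] at he ⊢
      exact ⟨by simp [he.1], fun w hw => Finset.mem_insert_of_mem (he.2 w hw)⟩
  have h3 := Finset.card_le_card h2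
  have n : ∀ z, s(v, z) ∉ ind E T := fun z hz => hv _ (mem_ind.1 hz).1 (by simp)
  rw [Finset.card_insert_of_notMem, Finset.card_insert_of_notMem,
    Finset.card_insert_of_notMem (n c)] at h3
  · omega
  · simp [n, hbc]; grind
  · simp [n, hab, hac]; grind

theorem exists_pair {E : Finset (Sym2 V)} {v a b c : V}
    (hv : ∀ e ∈ E, v ∉ e) (hab : a ≠ b) (hac : a ≠ c) (hbc : b ≠ c)
    (va : v ≠ a) (vb : v ≠ b) (vc : v ≠ c)
    (hE : Sparse (insert s(v, a) (insert s(v, b) (insert s(v, c) E)))) :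
    (s(a, b) ∉ E ∧ Sparse (insert s(a, b) E)) ∨ (s(b, c) ∉ E ∧ Sparse (insert s(b, c) E)) ∨
      (s(a, c) ∉ E ∧ Sparse (insert s(a, c) E)) := by
  by_contra! hcon
  obtain ⟨h1, h2, h3⟩ := hcon
  have hE0 : Sparse E := hE.mono (by intro e he; simp [he])
  obtain ⟨A, aA, bA, vA, tA⟩ := exists_tight hE0 hv hab va vb (fun h => h1 h.1 h.2)
  obtain ⟨B, bB, cB, vB, tB⟩ := exists_tight hE0 hv hbc vb vc (fun h => h2 h.1 h.2)
  obtain ⟨C, aC, cC, vC, tC⟩ := exists_tight hE0 hv hac va vc (fun h => h3 h.1 h.2)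
  have nb := fun (T : Finset V) (ha : a ∈ T) (hb : b ∈ T) (hc : c ∈ T) (hvT : v ∉ T) =>
    no_block hv hab hac hbc hE ha hb hc hvT
  by_cases iAB : 2 ≤ (A ∩ B).card
  · have := tight_union hE0 tA tB iAB
    have := nb (A ∪ B) (by simp [aA]) (by simp [bA]) (by simp [cB]) (by simp [vA, vB])
    omega
  by_cases iAC : 2 ≤ (A ∩ C).card
  · have := tight_union hE0 tA tC iAC
    have := nb (A ∪ C) (by simp [aA]) (by simp [bA]) (by simp [cC]) (by simp [vA, vC])
    omega
  by_cases iBC : 2 ≤ (B ∩ C).card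
  · have := tight_union hE0 tB tC iBC
    have := nb (B ∪ C) (by simp [aC]) (by simp [bB]) (by simp [cC]) (by simp [vB, vC])
    omega
  have dAB := ind_disj hE0.1 (A := A) (B := B) (by omega)
  have dAC := ind_disj hE0.1 (A := A) (B := C) (by omega)
  have dBC := ind_disj hE0.1 (A := B) (B := C) (by omega)
  have hT := nb (A ∪ B ∪ C) (by simp [aA]) (by simp [bA]) (by simp [cB]) (by simp [vA, vB, vC])
  have hU : (ind E A ∪ ind E B ∪ ind E C).card ≤ (ind E (A ∪ B ∪ C)).card := by
    apply Finset.card_le_card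
    refine Finset.union_subset (Finset.union_subset ?_ ?_) ?_ <;>
    · apply ind_mono (le_refl _)
      intro z hz
      simp [hz]
  rw [Finset.card_union_of_disjoint (Finset.disjoint_union_left.2 ⟨dAC, dBC⟩),
    Finset.card_union_of_disjoint dAB] at hU
  have u1 := Finset.card_union_add_card_inter A B
  have u2 := Finset.card_union_add_card_inter (A ∪ B) C
  have p1 : 1 ≤ (A ∩ B).card := Finset.card_pos.2 ⟨b, by simp [bA, bB]⟩
  have p2 : 2 ≤ ((A ∪ B) ∩ C).card := by
    rw [← Finset.card_pair hac]
    apply Finset.card_le_card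
    intro z hz
    simp only [Finset.mem_insert, Finset.mem_singleton] at hz
    rcases hz with rfl | rfl
    · simp [aA, aC]
    · simp [cB, cC]
  omega

theorem dec_leaf2 {E : Finset (Sym2 V)} {v a b : V}
    (hv : ∀ e ∈ E, v ∉ e) (hab : a ≠ b) (va : v ≠ a) (vb : v ≠ b) (h : Dec E) :
    Dec (insert s(v, a) (insert s(v, b) E)) := by
  obtain ⟨F, H, hU, hD, hF, hH⟩ := h
  subst hU
  have vF : ∀ e ∈ F, v ∉ e := fun e he => hv e (by simp [he])
  have vH : ∀ e ∈ H, v ∉ e := fun e he => hv e (by simp [he])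
  refine ⟨insert s(v, a) F, insert s(v, b) H, ?_, ?_, acyclic_leaf vF va hF,
    acyclic_leaf vH vb hH⟩
  · ext e; simp only [Finset.mem_insert, Finset.mem_union]; tauto
  · rw [Finset.disjoint_insert_left, Finset.disjoint_insert_right]
    refine ⟨?_, fun h => vF _ h (by simp), hD⟩
    rw [Finset.mem_insert]
    rintro (h | h)
    · exact hab (Sym2.congr_right.1 h)
    · exact vH _ h (by simp)

theorem dec_leaf1 {E : Finset (Sym2 V)} {v a : V}
    (hv : ∀ e ∈ E, v ∉ e) (va : v ≠ a) (h : Dec E) :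
    Dec (insert s(v, a) E) := by
  obtain ⟨F, H, hU, hD, hF, hH⟩ := h
  subst hU
  have vF : ∀ e ∈ F, v ∉ e := fun e he => hv e (by simp [he])
  have vH : ∀ e ∈ H, v ∉ e := fun e he => hv e (by simp [he])
  refine ⟨insert s(v, a) F, H, ?_, ?_, acyclic_leaf vF va hF, hH⟩
  · ext e; simp only [Finset.mem_insert, Finset.mem_union]; tauto
  · rw [Finset.disjoint_insert_left]
    exact ⟨fun h => vH _ h (by simp), hD⟩

theorem dec_sub {E : Finset (Sym2 V)} {v x y z : V}
    (hv : ∀ e ∈ E, v ∉ e) (hxy : x ≠ y) (hxz : x ≠ z) (hyz : y ≠ z)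
    (vx : v ≠ x) (vy : v ≠ y) (vz : v ≠ z) (hm : s(x, y) ∉ E)
    (h : Dec (insert s(x, y) E)) :
    Dec (insert s(v, x) (insert s(v, y) (insert s(v, z) E))) := by
  obtain ⟨F, H, hU, hD, hF, hH, hmem⟩ : ∃ F H : Finset (Sym2 V), F ∪ H = insert s(x, y) E ∧
      Disjoint F H ∧ (gr F).IsAcyclic ∧ (gr H).IsAcyclic ∧ s(x, y) ∈ F := by
    obtain ⟨F, H, hU, hD, hF, hH⟩ := h
    have : s(x, y) ∈ F ∪ H := by rw [hU]; simp
    rcases Finset.mem_union.1 this with h | h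
    · exact ⟨F, H, hU, hD, hF, hH, h⟩
    · exact ⟨H, F, by rw [Finset.union_comm, hU], hD.symm, hH, hF, h⟩
  have hmH : s(x, y) ∉ H := Finset.disjoint_left.1 hD hmem
  have hsub : ∀ e, (e ∈ F.erase s(x, y) ∨ e ∈ H) ↔ e ∈ E := by
    intro e
    have h1 : e ∈ F ∪ H ↔ e ∈ insert s(x, y) E := by rw [hU]
    simp only [Finset.mem_union, Finset.mem_insert] at h1
    rw [Finset.mem_erase]
    by_cases he : e = s(x, y)
    · subst he; tauto
    · tauto
  have vF : ∀ e ∈ F.erase s(x, y), v ∉ e := fun e he => hv e ((hsub e).1 (Or.inl he))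
  have vH : ∀ e ∈ H, v ∉ e := fun e he => hv e ((hsub e).1 (Or.inr he))
  have hr : ¬ (gr (F.erase s(x, y))).Reachable x y := by
    apply not_reach_of_acyclic hxy (by simp)
    rwa [Finset.insert_erase hmem]
  have hFe : (gr (F.erase s(x, y))).IsAcyclic := hF.anti (gr_mono (Finset.erase_subset _ _))
  refine ⟨insert s(v, y) (insert s(v, x) (F.erase s(x, y))), insert s(v, z) H, ?_, ?_,
    acyclic_subdiv vF vx vy hr hFe, acyclic_leaf vH vz hH⟩
  · ext e
    have := hsub e
    simp only [Finset.mem_insert, Finset.mem_union]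
    tauto
  · have nH : ∀ w, s(v, w) ∉ H := fun w h => vH _ h (by simp)
    have nF : ∀ w, s(v, w) ∉ F.erase s(x, y) := fun w h => vF _ h (by simp)
    have hD' : Disjoint (F.erase s(x, y)) H := hD.mono_left (Finset.erase_subset _ _)
    rw [Finset.disjoint_insert_left, Finset.disjoint_insert_left, Finset.disjoint_insert_right,
      Finset.mem_insert, Finset.mem_insert]
    refine ⟨?_, ?_, nF z, hD'⟩
    · rintro (h | h)
      · exact hyz (Sym2.congr_right.1 h)
      · exact nH _ h
    · rintro (h | h)
      · exact hxz (Sym2.congr_right.1 h)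
      · exact nH _ h

theorem exists_low_degree [Fintype V] {E : Finset (Sym2 V)} (hE : Sparse E) (hne : E.Nonempty) :
    ∃ v, 1 ≤ (E.filter (v ∈ ·)).card ∧ (E.filter (v ∈ ·)).card ≤ 3 := by
  by_contra! hcon
  set S : Finset V := Finset.univ.filter fun v => 1 ≤ (E.filter (v ∈ ·)).card with hS
  have hmemS : ∀ e ∈ E, ∀ v ∈ e, v ∈ S := by
    intro e he v hv
    simp only [hS, Finset.mem_filter, Finset.mem_univ, true_and]
    exact Finset.card_pos.2 ⟨e, by simp [he, hv]⟩
  have hind : ind E S = E := by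
    ext e; rw [mem_ind]; exact ⟨fun h => h.1, fun h => ⟨h, hmemS e h⟩⟩
  have hS2 : 2 ≤ S.card := by
    obtain ⟨e, he⟩ := hne
    rw [← Sym2.card_toFinset_of_not_isDiag e (hE.1 e he)]
    apply Finset.card_le_card
    intro v hv
    exact hmemS e he v (by simpa using hv)
  have h1 := hE.2 S hS2
  rw [hind] at h1
  have h2 := Finset.sum_card_bipartiteAbove_eq_sum_card_bipartiteBelow (s := S) (t := E)
    (fun (v : V) (e : Sym2 V) => v ∈ e)
  have h3 : ∑ e ∈ E, (S.bipartiteBelow (fun (v : V) (e : Sym2 V) => v ∈ e) e).card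
      = ∑ e ∈ E, 2 := by
    apply Finset.sum_congr rfl
    intro e he
    rw [← Sym2.card_toFinset_of_not_isDiag e (hE.1 e he)]
    congr 1
    ext v
    simp only [Finset.mem_bipartiteBelow, Sym2.mem_toFinset]
    exact ⟨fun h => h.2, fun h => ⟨hmemS e he v h, h⟩⟩
  have h4 : ∑ v ∈ S, 4 ≤
      ∑ v ∈ S, (E.bipartiteAbove (fun (v : V) (e : Sym2 V) => v ∈ e) v).card := by
    apply Finset.sum_le_sum
    intro v hv
    exact hcon v (by simpa [hS] using hv)
  simp only [Finset.sum_const, smul_eq_mul] at h3 h4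
  omega

theorem dec_of_sparse [Fintype V] (n : ℕ) : ∀ E : Finset (Sym2 V), E.card = n → Sparse E →
    Dec E := by
  induction n using Nat.strong_induction_on with
  | _ n ih =>
  intro E hn hE
  rcases E.eq_empty_or_nonempty with rfl | hne
  · exact ⟨∅, ∅, by simp, by simp, by simp [gr], by simp [gr]⟩
  obtain ⟨v, hv1, hv3⟩ := exists_low_degree hE hne
  set E0 := E.filter (fun e => v ∉ e) with hE0
  have hv0 : ∀ e ∈ E0, v ∉ e := fun e he => (Finset.mem_filter.1 he).2
  have hcard : (E.filter (v ∈ ·)).card + E0.card = n := by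
    rw [← hn, hE0]; exact Finset.card_filter_add_card_filter_not _
  have hEU : E.filter (v ∈ ·) ∪ E0 = E := Finset.filter_union_filter_not_eq _ _
  have hE0s : Sparse E0 := hE.mono (Finset.filter_subset _ _)
  have hinc : ∀ e ∈ E.filter (v ∈ ·), ∃ w, v ≠ w ∧ e = s(v, w) := by
    intro e he
    rw [Finset.mem_filter] at he
    obtain ⟨w, rfl⟩ := Sym2.mem_iff_exists.1 he.2
    exact ⟨w, by simpa using hE.1 _ he.1, rfl⟩
  have hd : Dec E0 := ih _ (by omega) E0 rfl hE0s
  have h123 : (E.filter (v ∈ ·)).card = 1 ∨ (E.filter (v ∈ ·)).card = 2 ∨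
    (E.filter (v ∈ ·)).card = 3 := by omega
  rcases h123 with h | h | h
  · obtain ⟨e, he⟩ := Finset.card_eq_one.1 h
    rw [he] at hinc hEU
    obtain ⟨a, va, rfl⟩ := hinc e (by simp)
    rw [← hEU]
    exact dec_leaf1 hv0 va hd
  · obtain ⟨e, f, hef, he⟩ := Finset.card_eq_two.1 h
    rw [he] at hinc hEU
    obtain ⟨a, va, rfl⟩ := hinc e (by simp)
    obtain ⟨b, vb, rfl⟩ := hinc f (by simp)
    rw [← hEU]
    have := dec_leaf2 hv0 (fun hab => hef (by rw [hab])) va vb hd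
    convert this using 1
    ext e; simp
  · obtain ⟨e, f, g, hef, heg, hfg, he⟩ := Finset.card_eq_three.1 h
    rw [he] at hinc hEU
    obtain ⟨a, va, rfl⟩ := hinc e (by simp)
    obtain ⟨b, vb, rfl⟩ := hinc f (by simp)
    obtain ⟨c, vc, rfl⟩ := hinc g (by simp)
    have hab : a ≠ b := fun hab => hef (by rw [hab])
    have hac : a ≠ c := fun hab => heg (by rw [hab])
    have hbc : b ≠ c := fun hab => hfg (by rw [hab])
    have hEU' : E = insert s(v, a) (insert s(v, b) (insert s(v, c) E0)) := by
      rw [← hEU]; ext e; simp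
    rw [hEU'] at hE ⊢
    have hlt : ∀ x y : V, (insert s(x, y) E0).card < n := by
      intro x y
      have := Finset.card_insert_le s(x, y) E0
      omega
    rcases exists_pair hv0 hab hac hbc va vb vc hE with ⟨hm, hs⟩ | ⟨hm, hs⟩ | ⟨hm, hs⟩
    · exact dec_sub hv0 hab hac hbc va vb vc hm (ih _ (hlt _ _) _ rfl hs)
    · have := dec_sub hv0 hbc hab.symm hac.symm vb vc va hm (ih _ (hlt _ _) _ rfl hs)
      convert this using 1
      ext e; simp only [Finset.mem_insert]; tauto
    · have := dec_sub hv0 hac hab hbc.symm va vc vb hm (ih _ (hlt _ _) _ rfl hs)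
      convert this using 1
      ext e; simp only [Finset.mem_insert]; tauto
end

/-- The edge set of a Laman graph on `n ≥ 2` vertices can be partitioned into a spanning tree
(with `n - 1` edges) and a spanning forest with exactly two connected components (hence with
`n - 2` edges). -/
theorem laman_partition_tree_and_two_component_forest {V : Type*} [Fintype V] [DecidableEq V]
    (G : SimpleGraph V) [DecidableRel G.Adj] (n : ℕ) (hn : Fintype.card V = n)
    (h2 : 2 ≤ n) (hG : IsLaman G) :
    ∃ E₁ E₂ : Finset (Sym2 V), E₁ ∪ E₂ = G.edgeFinset ∧ Disjoint E₁ E₂ ∧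
      (SimpleGraph.fromEdgeSet (↑E₁ : Set (Sym2 V))).IsTree ∧ E₁.card = n - 1 ∧
      (SimpleGraph.fromEdgeSet (↑E₂ : Set (Sym2 V))).IsAcyclic ∧
      Nat.card (SimpleGraph.fromEdgeSet (↑E₂ : Set (Sym2 V))).ConnectedComponent = 2 ∧
      E₂.card = n - 2 := by
  obtain ⟨hc, hS⟩ := hG
  have hdiag : ∀ e ∈ G.edgeFinset, ¬ e.IsDiag := fun e he =>
    G.not_isDiag_of_mem_edgeSet (by simpa using he)
  have hsp : Sparse G.edgeFinset := by
    refine ⟨hdiag, fun S h => ?_⟩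
    have : (ind G.edgeFinset S).card ≤ 2 * S.card - 3 := by
      have := hS S h
      convert this using 2
      ext e
      simp [mem_ind]
    omega
  obtain ⟨F, H, hU, hD, hF, hH⟩ := dec_of_sparse _ _ rfl hsp
  have hcard : F.card + H.card = 2 * n - 3 := by
    rw [← Finset.card_union_of_disjoint hD, hU, hc, hn]
  have cF := forest_card F (fun e he => hdiag e (by rw [← hU]; simp [he])) hF
  have cH := forest_card H (fun e he => hdiag e (by rw [← hU]; simp [he])) hH
  have : Nonempty V := Fintype.card_pos_iff.1 (by omega)
  have pF : 0 < Nat.card (gr F).ConnectedComponent := Nat.card_pos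
  have pH : 0 < Nat.card (gr H).ConnectedComponent := Nat.card_pos
  have tree : ∀ K : Finset (Sym2 V), (gr K).IsAcyclic →
      Nat.card (gr K).ConnectedComponent = 1 → (gr K).IsTree := by
    intro K hK h1
    have hss := (Nat.card_eq_one_iff_unique.1 h1).1
    refine ⟨⟨fun x y => ?_⟩, hK⟩
    exact SimpleGraph.ConnectedComponent.exact (Subsingleton.elim _ _)
  by_cases h : Nat.card (gr F).ConnectedComponent = 1
  · exact ⟨F, H, hU, hD, tree F hF h, by omega, hH, by change Nat.card (gr H).ConnectedComponent = 2; omega, by omega⟩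
  · exact ⟨H, F, by rw [Finset.union_comm, hU], hD.symm, tree H hH (by omega), by omega, hF,
      by change Nat.card (gr F).ConnectedComponent = 2; omega, by omega⟩
end
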